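/- Under the posterior π(κ | x, τ) ∝ κ^{a-1/2}(1-κ)^{-a-1} L((1/τ²)(1/κ-1)) e^{-κx²/2} on (0,1), with L slowly varying and a ∈ (0,1), there exists a constant A₀ ≥ 1 (on which L is locally bounded on [A₀,∞)) such that for every fixed τ < 1, E(1-κ | x, τ) ≤ (A₀K/(a(1-a))) e^{x²/2} τ^{2a} L(1/τ²) (1+o(1)), where the o(1) term is uniform in x and vanishes as τ → 0. -/

import Mathlib

open MeasureTheory Filter Set Topology

/-- The unnormalized posterior density of the shrinkage coefficient `κ ∈ (0,1)`
given observation `x` and global parameter `τ`. -/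
noncomputable def postDens (a : ℝ) (L : ℝ → ℝ) (τ x κ : ℝ) : ℝ :=
  κ ^ (a - 1/2) * (1 - κ) ^ (-a - 1) * L ((1 / τ ^ 2) * (1 / κ - 1)) *
    Real.exp (-(κ * x ^ 2) / 2)

/-- Uniform convergence theorem for additively slowly varying functions. -/
theorem exists_abs_sub_le_of_tendsto_sub {h : ℝ → ℝ} (hm : Measurable h)
    (hs : ∀ u, Tendsto (fun x => h (x + u) - h x) atTop (𝓝 0)) {ε : ℝ} (hε : 0 < ε) :
    ∃ X, ∀ x ≥ X, ∀ u ∈ Icc (0:ℝ) 1, |h (x + u) - h x| ≤ ε := by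
  set φ : ℝ → ℝ → ℝ := fun x u => min (ε / 2) |h (x + u) - h x| with hφ
  have hφ0 : ∀ x u, 0 ≤ φ x u := fun x u => le_min (by positivity) (abs_nonneg _)
  have hφ1 : ∀ x u, φ x u ≤ ε / 2 := fun x u => min_le_left _ _
  have hφm : ∀ x, Measurable (φ x) := fun x => by
    simp only [hφ]; fun_prop
  have hφn : ∀ x u, ‖φ x u‖ ≤ ε / 2 := fun x u => by
    rw [Real.norm_of_nonneg (hφ0 x u)]; exact hφ1 x u
  have hφi : ∀ x a b, IntervalIntegrable (φ x) volume a b := fun x a b =>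
    (intervalIntegrable_const (c := ε / 2)).mono_fun (hφm x).aestronglyMeasurable
      (Eventually.of_forall fun u => (hφn x u).trans (le_abs_self _))
  have hlim : Tendsto (fun x => ∫ u in (0:ℝ)..2, φ x u) atTop (𝓝 0) := by
    have := intervalIntegral.tendsto_integral_filter_of_dominated_convergence
      (μ := volume) (a := 0) (b := 2) (l := atTop) (F := φ) (f := fun _ => 0) (fun _ => ε / 2)
      (Eventually.of_forall fun x => (hφm x).aestronglyMeasurable)
      (Eventually.of_forall fun x => Eventually.of_forall fun u _ => hφn x u)
      intervalIntegrable_const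
      (Eventually.of_forall fun u _ => by
        have h1 := (tendsto_const_nhds (x := ε / 2)).min (hs u).abs
        simpa [hφ, min_eq_right (half_pos hε).le] using h1)
    simpa using this
  obtain ⟨X, hX⟩ := eventually_atTop.1 (hlim.eventually_lt_const (show 0 < ε / 4 by positivity))
  refine ⟨X, fun x hx u hu => ?_⟩
  by_contra! hcon
  have hpt : ∀ v, ε / 2 ≤ φ x v + φ (x + u) (v - u) := by
    intro v
    have htri := abs_sub_le (h (x + u)) (h (x + v)) (h x)
    rw [abs_sub_comm (h (x + u)) (h (x + v))] at htri
    simp only [hφ]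
    rw [show x + u + (v - u) = x + v by ring]
    rcases min_cases (ε / 2) |h (x + v) - h x| with h1 | h1 <;>
      rcases min_cases (ε / 2) |h (x + v) - h (x + u)| with h2 | h2 <;>
      linarith [abs_nonneg (h (x + v) - h x), abs_nonneg (h (x + v) - h (x + u))]
  have hmono : ∀ y a b, 0 ≤ a → a ≤ b → b ≤ 2 →
      ∫ v in a..b, φ y v ≤ ∫ v in (0:ℝ)..2, φ y v := fun y a b h1 h2 h3 =>
    intervalIntegral.integral_mono_interval h1 h2 h3
      (Eventually.of_forall fun v => hφ0 y v) (hφi y 0 2)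
  have hi : IntervalIntegrable (fun v => φ (x + u) (v - u)) volume 1 2 := by
    simpa using (hφi (x + u) (1 - u) (2 - u)).comp_sub_right u
  have hlow : ∫ v in (1:ℝ)..2, ε / 2 ≤ ∫ v in (1:ℝ)..2, (φ x v + φ (x + u) (v - u)) :=
    intervalIntegral.integral_mono_on (by norm_num) intervalIntegrable_const
      ((hφi x 1 2).add hi) fun v _ => hpt v
  rw [intervalIntegral.integral_add (hφi x 1 2) hi,
    intervalIntegral.integral_comp_sub_right (fun v => φ (x + u) v)] at hlow
  simp only [intervalIntegral.integral_const, smul_eq_mul] at hlow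
  have h1 := hmono x 1 2 zero_le_one one_le_two le_rfl
  have h2 := hmono (x + u) (1 - u) (2 - u) (by linarith [hu.2]) (by linarith)
    (by linarith [hu.1])
  have h3 := hX x hx
  have h4 := hX (x + u) (by linarith [hu.1])
  linarith

/-- Potter-type bound for additively slowly varying functions. -/
theorem exists_abs_sub_le_mul_add_one {h : ℝ → ℝ} (hm : Measurable h)
    (hs : ∀ u, Tendsto (fun x => h (x + u) - h x) atTop (𝓝 0)) {ε : ℝ} (hε : 0 < ε) :
    ∃ X, ∀ x ≥ X, ∀ u ≥ (0:ℝ), |h (x + u) - h x| ≤ ε * (u + 1) := by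
  obtain ⟨X, hX⟩ := exists_abs_sub_le_of_tendsto_sub hm hs hε
  have key : ∀ n : ℕ, ∀ x ≥ X, ∀ u : ℝ, 0 ≤ u → u ≤ n → |h (x + u) - h x| ≤ ε * n := by
    intro n
    induction n with
    | zero =>
      intro x _ u h0 h1
      have : u = 0 := le_antisymm (by simpa using h1) h0
      simp [this]
    | succ n ih =>
      intro x hx u h0 h1
      push_cast at h1 ⊢
      rcases le_total u 1 with hu | hu
      · have := hX x hx u ⟨h0, hu⟩
        nlinarith [mul_nonneg hε.le (Nat.cast_nonneg (α := ℝ) n)]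
      · have h2 := hX x hx 1 ⟨zero_le_one, le_rfl⟩
        have h3 := ih (x + 1) (by linarith) (u - 1) (by linarith) (by linarith)
        rw [show x + 1 + (u - 1) = x + u by ring] at h3
        have := abs_sub_le (h (x + u)) (h (x + 1)) (h x)
        linarith
  refine ⟨X, fun x hx u hu => (key _ x hx u hu (Nat.le_ceil u)).trans ?_⟩
  exact mul_le_mul_of_nonneg_left (Nat.ceil_lt_add_one hu).le hε.le

/-- Potter bounds for slowly varying functions. -/
theorem exists_potter_bound {L : ℝ → ℝ} (hLmeas : Measurable L) (hLpos : ∀ t > 0, 0 < L t)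
    (hslow : ∀ c > 0, Tendsto (fun x => L (c * x) / L x) atTop (𝓝 1)) {δ : ℝ} (hδ : 0 < δ) :
    ∃ X > 0, ∀ s ≥ X, ∀ t ≥ s,
      L t ≤ Real.exp δ * (t / s) ^ δ * L s ∧ L s ≤ Real.exp δ * (t / s) ^ δ * L t := by
  set h : ℝ → ℝ := fun x => Real.log (L (Real.exp x)) with hh
  have hm : Measurable h := by simp only [hh]; fun_prop
  have hs : ∀ u, Tendsto (fun x => h (x + u) - h x) atTop (𝓝 0) := by
    intro u
    have h1 := (hslow (Real.exp u) (Real.exp_pos u)).comp Real.tendsto_exp_atTop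
    have h2 := (Real.continuousAt_log one_ne_zero).tendsto.comp h1
    rw [Real.log_one] at h2
    refine h2.congr fun x => ?_
    simp only [Function.comp, hh]
    rw [Real.log_div (hLpos _ (by positivity)).ne' (hLpos _ (by positivity)).ne',
      Real.exp_add, mul_comm]
  obtain ⟨X, hX⟩ := exists_abs_sub_le_mul_add_one hm hs hδ
  refine ⟨Real.exp X, Real.exp_pos X, fun s hsX t hst => ?_⟩
  have hs0 : 0 < s := (Real.exp_pos X).trans_le hsX
  have ht0 : 0 < t := hs0.trans_le hst
  have hb := hX (Real.log s) ((Real.le_log_iff_exp_le hs0).2 hsX) (Real.log (t / s))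
    (Real.log_nonneg ((one_le_div hs0).2 hst))
  rw [Real.log_div ht0.ne' hs0.ne'] at hb
  simp only [hh, add_sub_cancel, Real.exp_log hs0, Real.exp_log ht0] at hb
  have he : Real.exp δ * (t / s) ^ δ = Real.exp (δ * (Real.log t - Real.log s + 1)) := by
    rw [Real.rpow_def_of_pos (by positivity), ← Real.exp_add, Real.log_div ht0.ne' hs0.ne']
    ring_nf
  rw [abs_le] at hb
  rw [he]
  constructor
  · rw [← Real.log_le_log_iff (hLpos t ht0) (mul_pos (Real.exp_pos _) (hLpos s hs0)),
      Real.log_mul (Real.exp_pos _).ne' (hLpos s hs0).ne', Real.log_exp]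
    linarith
  · rw [← Real.log_le_log_iff (hLpos s hs0) (mul_pos (Real.exp_pos _) (hLpos t ht0)),
      Real.log_mul (Real.exp_pos _).ne' (hLpos t ht0).ne', Real.log_exp]
    linarith

/-- Change of variables `κ = 1 / (1 + q t)`. -/
theorem integral_Ioo_eq_integral_Ioi_one_div {q : ℝ} (hq : 0 < q) (F : ℝ → ℝ) :
    ∫ κ in Ioo (0:ℝ) 1, F κ =
      ∫ t in Ioi (0:ℝ), q / (1 + q * t) ^ 2 * F (1 / (1 + q * t)) := by
  have himg : (fun t : ℝ => 1 / (1 + q * t)) '' Ioi 0 = Ioo 0 1 := by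
    ext κ
    constructor
    · rintro ⟨t, ht, rfl⟩
      have : 0 < q * t := mul_pos hq ht
      exact ⟨by positivity, by rw [div_lt_one (by positivity)]; linarith⟩
    · rintro ⟨h0, h1⟩
      refine ⟨(1 / κ - 1) / q, div_pos (sub_pos.2 ((one_lt_div h0).2 h1)) hq, ?_⟩
      have := hq.ne'
      have := h0.ne'
      field_simp
      ring
  rw [← himg, integral_image_eq_integral_abs_deriv_smul (f' := fun t => -q / (1 + q * t) ^ 2)
    measurableSet_Ioi]
  · refine setIntegral_congr_fun measurableSet_Ioi fun t ht => ?_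
    simp only [smul_eq_mul]
    rw [abs_div, abs_neg, abs_of_pos hq, abs_of_nonneg (sq_nonneg _)]
  · intro t ht
    have : 0 < q * t := mul_pos hq ht
    have h1 : HasDerivAt (fun t : ℝ => 1 + q * t) q t := by
      simpa using ((hasDerivAt_id t).const_mul q).const_add 1
    simp only [one_div]
    exact (h1.inv (by positivity)).hasDerivWithinAt
  · intro s hs t ht hst
    have h1 : 0 < q * s := mul_pos hq hs
    have h2 : 0 < q * t := mul_pos hq ht
    simp only at hst
    rw [div_eq_div_iff (by positivity) (by positivity)] at hst
    exact mul_left_cancel₀ hq.ne' (by linarith)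

/-- The posterior density in the variable `t = (1 / κ - 1) / τ ^ 2`. -/
theorem jacobian_mul_postDens {a τ x t : ℝ} {L : ℝ → ℝ} (hτ : 0 < τ) (ht : 0 < t) :
    τ ^ 2 / (1 + τ ^ 2 * t) ^ 2 * postDens a L τ x (1 / (1 + τ ^ 2 * t)) =
      τ ^ (-(2 * a)) * (t ^ (-a - 1) * L t * ((1 + τ ^ 2 * t) ^ (-(1/2) : ℝ) *
        Real.exp (-(1 / (1 + τ ^ 2 * t) * x ^ 2) / 2))) := by
  unfold postDens
  set p := 1 + τ ^ 2 * t with hp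
  have hp0 : 0 < p := by positivity
  have h1 : 1 / τ ^ 2 * (1 / (1 / p) - 1) = t := by
    rw [hp]; field_simp; ring
  have h2 : 1 - 1 / p = τ ^ 2 * t / p := by
    rw [hp]; field_simp; ring
  have h3 : (1 / p) ^ (a - 1/2) = p ^ (-(a - 1/2)) := by
    rw [one_div, Real.inv_rpow hp0.le, Real.rpow_neg hp0.le]
  have h4 : (τ ^ 2 * t / p) ^ (-a - 1) = τ ^ (-(2 * a)) * (τ ^ 2)⁻¹ * t ^ (-a - 1) *
      p ^ (a + 1) := by
    rw [Real.div_rpow (by positivity) hp0.le, Real.mul_rpow (by positivity) ht.le,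
      div_eq_mul_inv, ← Real.rpow_neg hp0.le, ← Real.rpow_natCast τ 2, ← Real.rpow_mul hτ.le,
      ← Real.rpow_neg hτ.le, ← Real.rpow_add hτ]
    push_cast
    ring_nf
  have h5 : p ^ (-(1/2) : ℝ) = p ^ (-(a - 1/2)) * p ^ (a + 1) * (p ^ 2)⁻¹ := by
    rw [← Real.rpow_natCast p 2, ← Real.rpow_neg hp0.le, ← Real.rpow_add hp0,
      ← Real.rpow_add hp0]
    push_cast
    ring_nf
  rw [h1, h2, h3, h4, h5]
  field_simp

/-- One-sided Karamata estimate for truncated moments, derived from Potter bounds. -/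
theorem exists_integral_mul_min_le {a : ℝ} {L : ℝ → ℝ}
    (hLpos : ∀ t > 0, 0 < L t)
    (hw : IntegrableOn (fun t => t ^ (-a - 1) * L t) (Ioi 0)) {δ X : ℝ} (hδ : 0 < δ)
    (hδa : δ < a) (hδa' : δ < 1 - a) (hX : 0 < X)
    (hL : ∀ s ≥ X, ∀ t ≥ s,
      L t ≤ Real.exp δ * (t / s) ^ δ * L s ∧ L s ≤ Real.exp δ * (t / s) ^ δ * L t) :
    ∃ C, ∀ T ≥ X, ∫ t in Ioi (0:ℝ), t ^ (-a - 1) * L t * min 1 (t / T) ≤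
      C * (T ^ (-a) * L T) := by
  set D : ℝ := Real.exp δ with hD
  have hD0 : 0 < D := Real.exp_pos δ
  set I : ℝ := ∫ t in Ioi (0:ℝ), t ^ (-a - 1) * L t with hI
  have hw0 : ∀ t > 0, 0 ≤ t ^ (-a - 1) * L t := fun t ht =>
    mul_nonneg (Real.rpow_nonneg (le_of_lt ht) _) (hLpos t ht).le
  have hI0 : 0 ≤ I := setIntegral_nonneg measurableSet_Ioi hw0
  have hLX := hLpos X hX
  refine ⟨X * I * D / (X ^ (1 - a) * L X) + D / (1 - a - δ) + D / (a - δ), fun T hT => ?_⟩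
  have hT0 : 0 < T := hX.trans_le hT
  have hLT := hLpos T hT0
  have hmin : IntegrableOn (fun t => t ^ (-a - 1) * L t * min 1 (t / T)) (Ioi 0) := by
    refine hw.mono' (hw.aestronglyMeasurable.mul (by fun_prop))
      (ae_restrict_of_forall_mem measurableSet_Ioi fun t ht => ?_)
    have h1 : 0 ≤ min 1 (t / T) := le_min zero_le_one (div_nonneg (le_of_lt ht) hT0.le)
    rw [Real.norm_of_nonneg (mul_nonneg (hw0 t ht) h1)]
    exact mul_le_of_le_one_right (hw0 t ht) (min_le_left _ _)
  have hT1 : 1 / T ≤ D / (X ^ (1 - a) * L X) * (T ^ (-a) * L T) := by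
    have h1 := (hL X le_rfl T hT).2
    have h2 : (T / X) ^ δ ≤ (T / X) ^ (1 - a) :=
      Real.rpow_le_rpow_of_exponent_le ((one_le_div hX).2 hT) hδa'.le
    have h3 : L X ≤ D * (T ^ (1 - a) / X ^ (1 - a)) * L T := by
      rw [← Real.div_rpow hT0.le hX.le]
      exact h1.trans (by gcongr)
    have h4 : T ^ (1 - a) = T ^ (-a) * T := by
      rw [show 1 - a = -a + 1 by ring, Real.rpow_add hT0, Real.rpow_one]
    rw [h4] at h3
    have hXa : 0 < X ^ (1 - a) := by positivity
    rw [div_mul_eq_mul_div, div_le_div_iff₀ hT0 (by positivity)]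
    calc 1 * (X ^ (1 - a) * L X)
        ≤ X ^ (1 - a) * (D * (T ^ (-a) * T / X ^ (1 - a)) * L T) := by
          rw [one_mul]; gcongr
      _ = D * (T ^ (-a) * L T) * T := by field_simp
  have hlo : ∫ t in Ioc 0 T, t ^ (-a - 1) * L t * min 1 (t / T) ≤
      X * I * (1 / T) + D / (1 - a - δ) * (T ^ (-a) * L T) := by
    have hr : IntegrableOn (fun t : ℝ => t ^ (-a - δ)) (Ioc 0 T) :=
      (intervalIntegrable_iff_integrableOn_Ioc_of_le hT0.le).1
        (intervalIntegral.intervalIntegrable_rpow' (by linarith))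
    have hwT : IntegrableOn (fun t => t ^ (-a - 1) * L t) (Ioc 0 T) :=
      hw.mono_set Ioc_subset_Ioi_self
    have hle : ∫ t in Ioc 0 T, t ^ (-a - 1) * L t * min 1 (t / T) ≤
        ∫ t in Ioc 0 T, (X / T * (t ^ (-a - 1) * L t) +
          D * L T * T ^ (δ - 1) * t ^ (-a - δ)) := by
      refine setIntegral_mono_on (hmin.mono_set Ioc_subset_Ioi_self)
        ((hwT.const_mul _).add (hr.const_mul _)) measurableSet_Ioc fun t ht => ?_
      have ht0 : 0 < t := ht.1
      have h0 := hw0 t ht0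
      rcases le_total t X with htX | htX
      · have h1 : min 1 (t / T) ≤ X / T := (min_le_right _ _).trans (by gcongr)
        have h2 : 0 ≤ D * L T * T ^ (δ - 1) * t ^ (-a - δ) := by positivity
        nlinarith
      · have h1 := (hL t htX T ht.2).2
        have h2 : t ^ (-a - 1) * (D * (T / t) ^ δ * L T) * (t / T) =
            D * L T * T ^ (δ - 1) * t ^ (-a - δ) := by
          rw [Real.div_rpow hT0.le ht0.le, Real.rpow_sub hT0, Real.rpow_sub ht0,
            Real.rpow_sub ht0, Real.rpow_one, Real.rpow_one]
          field_simp
        calc t ^ (-a - 1) * L t * min 1 (t / T)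
            ≤ t ^ (-a - 1) * (D * (T / t) ^ δ * L T) * (t / T) := by
              gcongr
              exact min_le_right _ _
          _ ≤ _ := by rw [h2]; linarith [mul_nonneg (div_nonneg hX.le hT0.le) h0]
    refine hle.trans ?_
    rw [integral_add (hwT.const_mul _) (hr.const_mul _), integral_const_mul,
      integral_const_mul, ← intervalIntegral.integral_of_le hT0.le (f := fun t => t ^ (-a - δ)),
      integral_rpow (Or.inl (by linarith)), Real.zero_rpow (by linarith), sub_zero]
    have h1 : ∫ t in Ioc 0 T, t ^ (-a - 1) * L t ≤ I :=
      setIntegral_mono_set hw (ae_restrict_of_forall_mem measurableSet_Ioi hw0)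
        Ioc_subset_Ioi_self.eventuallyLE
    have h2 : D * L T * T ^ (δ - 1) * (T ^ (-a - δ + 1) / (-a - δ + 1)) =
        D / (1 - a - δ) * (T ^ (-a) * L T) := by
      rw [show -a - δ + 1 = 1 - a - δ by ring,
        show T ^ (-a) = T ^ (δ - 1) * T ^ (1 - a - δ) by
          rw [← Real.rpow_add hT0]; ring_nf]
      ring
    rw [h2]
    have h3 : X / T * ∫ t in Ioc 0 T, t ^ (-a - 1) * L t ≤ X / T * I := by gcongr
    calc _ ≤ X / T * I + D / (1 - a - δ) * (T ^ (-a) * L T) := by gcongr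
      _ = _ := by ring
  have hhi : ∫ t in Ioi T, t ^ (-a - 1) * L t * min 1 (t / T) ≤
      D / (a - δ) * (T ^ (-a) * L T) := by
    have hr : IntegrableOn (fun t : ℝ => t ^ (δ - a - 1)) (Ioi T) :=
      integrableOn_Ioi_rpow_of_lt (by linarith) hT0
    have hle : ∫ t in Ioi T, t ^ (-a - 1) * L t * min 1 (t / T) ≤
        ∫ t in Ioi T, D * L T * T ^ (-δ) * t ^ (δ - a - 1) := by
      refine setIntegral_mono_on (hmin.mono_set (Ioi_subset_Ioi hT0.le))
        (hr.const_mul _) measurableSet_Ioi fun t ht => ?_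
      have ht0 : 0 < t := hT0.trans ht
      have h1 := (hL T hT t (le_of_lt ht)).1
      have h2 : t ^ (-a - 1) * (D * (t / T) ^ δ * L T) =
          D * L T * T ^ (-δ) * t ^ (δ - a - 1) := by
        rw [Real.div_rpow ht0.le hT0.le, show δ - a - 1 = (-a - 1) + δ by ring,
          Real.rpow_add ht0, Real.rpow_neg hT0.le]
        ring
      rw [← h2]
      refine (mul_le_of_le_one_right (hw0 t ht0) (min_le_left _ _)).trans ?_
      gcongr
    refine hle.trans (le_of_eq ?_)
    rw [integral_const_mul, integral_Ioi_rpow_of_lt (by linarith) hT0,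
      show T ^ (-a) = T ^ (-δ) * T ^ (δ - a - 1 + 1) by
        rw [← Real.rpow_add hT0]; ring_nf,
      show δ - a - 1 + 1 = -(a - δ) by ring, neg_div_neg_eq]
    ring
  rw [← Ioc_union_Ioi_eq_Ioi hT0.le, setIntegral_union (Ioc_disjoint_Ioi le_rfl)
    measurableSet_Ioi (hmin.mono_set Ioc_subset_Ioi_self)
    (hmin.mono_set (Ioi_subset_Ioi hT0.le))]
  have hXI : X * I * (1 / T) ≤ X * I * (D / (X ^ (1 - a) * L X) * (T ^ (-a) * L T)) := by
    gcongr
  calc _ ≤ (X * I * (D / (X ^ (1 - a) * L X) * (T ^ (-a) * L T)) +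
        D / (1 - a - δ) * (T ^ (-a) * L T)) + D / (a - δ) * (T ^ (-a) * L T) := by
        linarith
    _ = _ := by ring

/-- Lower bound for the normalizing constant of the posterior. -/
theorem integral_postDens_ge {a τ : ℝ} {L : ℝ → ℝ}
    (hLpos : ∀ t > 0, 0 < L t) (hw : IntegrableOn (fun t => t ^ (-a - 1) * L t) (Ioi 0))
    (hτ : τ ∈ Ioo (0:ℝ) 1) (x : ℝ) :
    τ ^ (-(2 * a)) * ((∫ t in Ioi (0:ℝ), t ^ (-a - 1) * L t * (1 + t) ^ (-(1/2) : ℝ)) *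
      Real.exp (-(x ^ 2 / 2))) ≤ ∫ κ in Ioo (0:ℝ) 1, postDens a L τ x κ := by
  have hτ0 := hτ.1
  have hw0 : ∀ t > 0, 0 ≤ t ^ (-a - 1) * L t := fun t ht =>
    mul_nonneg (Real.rpow_nonneg (le_of_lt ht) _) (hLpos t ht).le
  have hbdd : ∀ {f : ℝ → ℝ}, Measurable f → (∀ t > 0, 0 ≤ f t) → (∀ t > 0, f t ≤ 1) →
      IntegrableOn (fun t => t ^ (-a - 1) * L t * f t) (Ioi 0) := fun hf h0 h1 =>
    hw.mono' (hw.aestronglyMeasurable.mul hf.aestronglyMeasurable)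
      (ae_restrict_of_forall_mem measurableSet_Ioi fun t ht => by
        rw [Real.norm_of_nonneg (mul_nonneg (hw0 t ht) (h0 t ht))]
        exact mul_le_of_le_one_right (hw0 t ht) (h1 t ht))
  rw [integral_Ioo_eq_integral_Ioi_one_div (pow_pos hτ0 2),
    setIntegral_congr_fun measurableSet_Ioi fun t ht => jacobian_mul_postDens hτ0 ht,
    integral_const_mul, ← integral_mul_const]
  refine mul_le_mul_of_nonneg_left ?_ (by positivity)
  refine setIntegral_mono_on (Integrable.mul_const (hbdd (by fun_prop) (fun t ht => ?_)
    fun t ht => ?_) _) (hbdd (by fun_prop) (fun t ht => ?_) fun t ht => ?_)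
    measurableSet_Ioi fun t ht => ?_
  · have : 0 < t := ht
    positivity
  · exact Real.rpow_le_one_of_one_le_of_nonpos (by linarith) (by norm_num)
  · have : 0 < t := ht
    positivity
  · have h1 : 0 < τ ^ 2 * t := mul_pos (pow_pos hτ0 2) ht
    refine mul_le_one₀ (Real.rpow_le_one_of_one_le_of_nonpos (by linarith) (by norm_num))
      (by positivity) (Real.exp_le_one_iff.2 ?_)
    have : 0 ≤ 1 / (1 + τ ^ 2 * t) * x ^ 2 := by positivity
    linarith
  · have ht0 : 0 < t := ht
    have h1 : 0 < τ ^ 2 * t := mul_pos (pow_pos hτ0 2) ht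
    have h2 : τ ^ 2 * t ≤ t := mul_le_of_le_one_left ht0.le (pow_le_one₀ hτ0.le hτ.2.le)
    rw [mul_assoc]
    refine mul_le_mul_of_nonneg_left ?_ (hw0 t ht0)
    refine mul_le_mul (Real.rpow_le_rpow_of_nonpos (by positivity) (by linarith) (by norm_num))
      (Real.exp_le_exp.2 ?_) (Real.exp_pos _).le (by positivity)
    have h3 : 1 / (1 + τ ^ 2 * t) ≤ 1 := by
      rw [div_le_one (by positivity)]; linarith
    nlinarith [mul_le_of_le_one_left (sq_nonneg x) h3]

/-- Upper bound for the unnormalized posterior first moment of `1 - κ`. -/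
theorem integral_one_sub_mul_postDens_le {a τ : ℝ} {L : ℝ → ℝ}
    (hLpos : ∀ t > 0, 0 < L t) (hw : IntegrableOn (fun t => t ^ (-a - 1) * L t) (Ioi 0))
    (hτ : 0 < τ) (x : ℝ) :
    ∫ κ in Ioo (0:ℝ) 1, (1 - κ) * postDens a L τ x κ ≤ τ ^ (-(2 * a)) *
      ∫ t in Ioi (0:ℝ), t ^ (-a - 1) * L t * min 1 (t / (1 / τ ^ 2)) := by
  have hw0 : ∀ t > 0, 0 ≤ t ^ (-a - 1) * L t := fun t ht =>
    mul_nonneg (Real.rpow_nonneg (le_of_lt ht) _) (hLpos t ht).le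
  have hmin0 : ∀ t > 0, 0 ≤ min 1 (t / (1 / τ ^ 2)) := fun t ht =>
    le_min zero_le_one (div_nonneg (le_of_lt ht) (by positivity))
  have hmin : IntegrableOn (fun t => t ^ (-a - 1) * L t * min 1 (t / (1 / τ ^ 2))) (Ioi 0) := by
    refine hw.mono' (hw.aestronglyMeasurable.mul (by fun_prop))
      (ae_restrict_of_forall_mem measurableSet_Ioi fun t ht => ?_)
    rw [Real.norm_of_nonneg (mul_nonneg (hw0 t ht) (hmin0 t ht))]
    exact mul_le_of_le_one_right (hw0 t ht) (min_le_left _ _)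
  have hcongr : ∀ t ∈ Ioi (0:ℝ), τ ^ 2 / (1 + τ ^ 2 * t) ^ 2 *
      ((1 - 1 / (1 + τ ^ 2 * t)) * postDens a L τ x (1 / (1 + τ ^ 2 * t))) =
      τ ^ (-(2 * a)) * (t ^ (-a - 1) * L t * ((1 - 1 / (1 + τ ^ 2 * t)) *
        ((1 + τ ^ 2 * t) ^ (-(1/2) : ℝ) *
          Real.exp (-(1 / (1 + τ ^ 2 * t) * x ^ 2) / 2)))) := fun t ht => by
    rw [mul_left_comm, jacobian_mul_postDens hτ ht]
    ring
  rw [integral_Ioo_eq_integral_Ioi_one_div (pow_pos hτ 2),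
    setIntegral_congr_fun measurableSet_Ioi hcongr, integral_const_mul]
  refine mul_le_mul_of_nonneg_left ?_ (by positivity)
  have hfac : ∀ t > 0, 0 ≤ 1 - 1 / (1 + τ ^ 2 * t) ∧
      1 - 1 / (1 + τ ^ 2 * t) ≤ min 1 (t / (1 / τ ^ 2)) := fun t ht => by
    have h1 : 0 < τ ^ 2 * t := mul_pos (pow_pos hτ 2) ht
    have h2 : 1 - 1 / (1 + τ ^ 2 * t) = τ ^ 2 * t / (1 + τ ^ 2 * t) := by
      field_simp; ring
    rw [h2]
    refine ⟨by positivity, le_min ((div_le_one (by positivity)).2 (by linarith)) ?_⟩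
    rw [div_div_eq_mul_div, div_one, mul_comm t]
    exact div_le_self h1.le (by linarith)
  refine integral_mono_of_nonneg
    (ae_restrict_of_forall_mem measurableSet_Ioi fun t ht => ?_) hmin
    (ae_restrict_of_forall_mem measurableSet_Ioi fun t ht => ?_)
  · have ht0 : 0 < t := ht
    exact mul_nonneg (hw0 t ht) (mul_nonneg (hfac t ht).1 (by positivity))
  · have h1 : 0 < τ ^ 2 * t := mul_pos (pow_pos hτ 2) ht
    refine mul_le_mul_of_nonneg_left ?_ (hw0 t ht)
    refine (mul_le_of_le_one_right (hfac t ht).1 ?_).trans (hfac t ht).2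
    refine mul_le_one₀ (Real.rpow_le_one_of_one_le_of_nonpos (by linarith) (by norm_num))
      (by positivity) (Real.exp_le_one_iff.2 ?_)
    have : 0 ≤ 1 / (1 + τ ^ 2 * t) * x ^ 2 := by positivity
    linarith

/-- Theorem 4.2 (moment inequality): with `L` slowly varying and `a ∈ (0,1)`,
there is `A₀ ≥ 1`, on `[A₀,∞)` of which `L` is locally bounded, such that for
every fixed `τ < 1`,
`E(1-κ | x, τ) ≤ (A₀K/(a(1-a))) e^{x²/2} τ^{2a} L(1/τ²) (1+o(1))`,
the `o(1)` term being uniform in `x` and vanishing as `τ → 0⁺`. -/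
theorem posterior_mean_bound_slowly_varying (a K : ℝ) (ha : a ∈ Ioo (0:ℝ) 1)
    (hK : 0 < K) (L : ℝ → ℝ)
    (hLmeas : Measurable L)
    (hLpos : ∀ t > 0, 0 < L t)
    (hslow : ∀ c > 0, Tendsto (fun x => L (c * x) / L x) atTop (𝓝 1))
    (hnorm : K * ∫ t in Ioi (0:ℝ), t ^ (-a - 1) * L t = 1) :
    ∃ A₀ ≥ (1:ℝ),
      (∀ b ≥ A₀, ∃ M : ℝ, ∀ t ∈ Icc A₀ b, L t ≤ M) ∧
      ∃ g : ℝ → ℝ, Tendsto g (𝓝[>] 0) (𝓝 0) ∧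
        ∀ τ ∈ Ioo (0:ℝ) 1, ∀ x : ℝ,
          (∫ κ in Ioo (0:ℝ) 1, (1 - κ) * postDens a L τ x κ) /
              (∫ κ in Ioo (0:ℝ) 1, postDens a L τ x κ) ≤
            (A₀ * K / (a * (1 - a))) * Real.exp (x ^ 2 / 2) * τ ^ (2 * a) *
              L (1 / τ ^ 2) * (1 + g τ) := by
  obtain ⟨ha0, ha1⟩ := ha
  have hw : IntegrableOn (fun t => t ^ (-a - 1) * L t) (Ioi 0) := by
    by_contra h
    rw [integral_undef h, mul_zero] at hnorm
    exact zero_ne_one hnorm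
  set δ := min a (1 - a) / 2 with hδ
  have hmin0 : 0 < min a (1 - a) := lt_min ha0 (by linarith)
  have hδ0 : 0 < δ := half_pos hmin0
  have hδa : δ < a := (half_lt_self hmin0).trans_le (min_le_left _ _)
  have hδa' : δ < 1 - a := (half_lt_self hmin0).trans_le (min_le_right _ _)
  obtain ⟨X, hX, hL⟩ := exists_potter_bound hLmeas hLpos hslow hδ0
  obtain ⟨C, hC⟩ := exists_integral_mul_min_le hLpos hw hδ0 hδa hδa' hX hL
  set m : ℝ → ℝ := fun T => ∫ t in Ioi (0:ℝ), t ^ (-a - 1) * L t * min 1 (t / T) with hm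
  set c : ℝ := ∫ t in Ioi (0:ℝ), t ^ (-a - 1) * L t * (1 + t) ^ (-(1/2) : ℝ) with hc
  have hc0 : 0 < c := by
    have hpos : ∀ t ∈ Ioi (0:ℝ), 0 < t ^ (-a - 1) * L t * (1 + t) ^ (-(1/2) : ℝ) :=
      fun t (ht : 0 < t) => mul_pos (mul_pos (Real.rpow_pos_of_pos ht _) (hLpos t ht))
        (by positivity)
    have hint : IntegrableOn (fun t => t ^ (-a - 1) * L t * (1 + t) ^ (-(1/2) : ℝ)) (Ioi 0) := by
      refine hw.mono' (by fun_prop) (ae_restrict_of_forall_mem measurableSet_Ioi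
        fun t (ht : 0 < t) => ?_)
      rw [Real.norm_of_nonneg (hpos t ht).le]
      exact mul_le_of_le_one_right
        (mul_nonneg (Real.rpow_nonneg ht.le _) (hLpos t ht).le)
        (Real.rpow_le_one_of_one_le_of_nonpos (by linarith) (by norm_num))
    rw [hc, setIntegral_pos_iff_support_of_nonneg_ae
      (ae_restrict_of_forall_mem measurableSet_Ioi fun t ht => (hpos t ht).le) hint,
      inter_eq_right.2 fun t ht => Function.mem_support.2 (hpos t ht).ne']
    simp
  have haa : 0 < a * (1 - a) := mul_pos ha0 (by linarith)
  set A := max (max 1 X) (C / c * (a * (1 - a)) / K) with hA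
  have hA1 : 1 ≤ A := (le_max_left _ _).trans (le_max_left _ _)
  have hAX : X ≤ A := (le_max_right _ _).trans (le_max_left _ _)
  have hAC : C / c ≤ A * K / (a * (1 - a)) := by
    rw [le_div_iff₀ haa, ← div_le_iff₀ hK]
    exact le_max_right _ _
  have hA0 : 0 < A := by linarith
  set B : ℝ → ℝ := fun τ => A * K / (a * (1 - a)) * τ ^ (2 * a) * L (1 / τ ^ 2) with hB
  have hB0 : ∀ τ > 0, 0 < B τ := fun τ hτ =>
    mul_pos (by have : 0 < τ := hτ; positivity) (hLpos _ (by have : 0 < τ := hτ; positivity))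
  refine ⟨A, hA1, fun b _ => ⟨Real.exp δ * (b / X) ^ δ * L X, fun t ht => ?_⟩,
    fun τ => max 0 (m (1 / τ ^ 2) / c / B τ - 1), ?_, fun τ hτ x => ?_⟩
  · have hXt := hAX.trans ht.1
    have ht0 : 0 < t := hX.trans_le hXt
    have hLX := hLpos X hX
    refine (hL X le_rfl t hXt).1.trans ?_
    gcongr
    exact ht.2
  · refine tendsto_const_nhds.congr' ?_
    have hT : Tendsto (fun τ : ℝ => 1 / τ ^ 2) (𝓝[>] 0) atTop := by
      have := (tendsto_pow_atTop two_ne_zero).comp (tendsto_inv_nhdsGT_zero (𝕜 := ℝ))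
      simpa [Function.comp_def, one_div] using this
    filter_upwards [hT.eventually_ge_atTop X, self_mem_nhdsWithin] with τ hτX (hτ : 0 < τ)
    have hpow : (1 / τ ^ 2) ^ (-a) = τ ^ (2 * a) := by
      rw [one_div, Real.inv_rpow (by positivity), Real.rpow_neg (by positivity), inv_inv,
        ← Real.rpow_natCast, ← Real.rpow_mul hτ.le]
      norm_num
    have hle : m (1 / τ ^ 2) / c ≤ B τ := by
      have h1 := hC _ hτX
      rw [hpow] at h1
      have h2 := hLpos (1 / τ ^ 2) (by positivity)
      calc m (1 / τ ^ 2) / c ≤ C * (τ ^ (2 * a) * L (1 / τ ^ 2)) / c := by gcongr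
        _ = C / c * (τ ^ (2 * a) * L (1 / τ ^ 2)) := by ring
        _ ≤ A * K / (a * (1 - a)) * (τ ^ (2 * a) * L (1 / τ ^ 2)) := by gcongr
        _ = B τ := by rw [hB]; ring
    rw [eq_comm, max_eq_left]
    linarith [(div_le_one (hB0 τ hτ)).2 hle]
  · have hτ0 := hτ.1
    have hD := integral_postDens_ge hLpos hw hτ x
    have hN := integral_one_sub_mul_postDens_le hLpos hw hτ0 x
    have hm0 : 0 ≤ m (1 / τ ^ 2) := setIntegral_nonneg measurableSet_Ioi
      fun t (ht : 0 < t) => mul_nonneg (mul_nonneg (Real.rpow_nonneg ht.le _) (hLpos t ht).le)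
        (le_min zero_le_one (by positivity))
    have hBτ := hB0 τ hτ0
    have hg : m (1 / τ ^ 2) / c ≤ B τ * (1 + max 0 (m (1 / τ ^ 2) / c / B τ - 1)) := by
      have h1 := le_max_right 0 (m (1 / τ ^ 2) / c / B τ - 1)
      calc m (1 / τ ^ 2) / c = B τ * (m (1 / τ ^ 2) / c / B τ) := by field_simp
        _ ≤ _ := by gcongr; linarith
    calc _ ≤ τ ^ (-(2 * a)) * m (1 / τ ^ 2) /
          (τ ^ (-(2 * a)) * (c * Real.exp (-(x ^ 2 / 2)))) := by
          refine div_le_div₀ (by positivity) hN (by positivity) hD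
      _ = Real.exp (x ^ 2 / 2) * (m (1 / τ ^ 2) / c) := by
          rw [Real.exp_neg]
          have : τ ^ (-(2 * a)) ≠ 0 := by positivity
          field_simp
      _ ≤ Real.exp (x ^ 2 / 2) * (B τ * (1 + max 0 (m (1 / τ ^ 2) / c / B τ - 1))) := by
          gcongr
      _ = _ := by rw [hB]; ring
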